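/- arXiv:2403.00858 — 2 statements merged into one kernel-verified Lean document; each statement's English description precedes it below -/
import Mathlib

section
/- Let V be a finite nonempty set, let q be a fixed probability mass function on V, and let θ ↦ p_θ be a parametric family of probability mass functions on V, parametrized by θ ∈ ℝ^d, such that for each x ∈ V the map θ ↦ p_θ(x) is differentiable at a point θ₀, with p_{θ₀}(x) > 0 and q(x) ≠ p_{θ₀}(x) for all x ∈ V. Then the map θ ↦ TVD(p_θ, q) is differentiable at θ₀ and its gradient equals ∇_θ TVD(p_θ, q)|_{θ₀} = Σ_{x ∈ V} p_{θ₀}(x) · ∇_θ log p_θ(x)|_{θ₀} · (−r(x)), where r(x) := 1 if q(x) > p_{θ₀}(x) and r(x) := 0 otherwise; equivalently, ∇_θ TVD(p_θ, q)|_{θ₀} = E_{X ∼ p_{θ₀}}[∇_θ log p_θ(X)|_{θ₀} · (−r(X))]. -/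
/-- Away from the kink, `t ↦ |a - t|` composed with a differentiable function has derivative
`f'` or `-f'` according to the sign of `f x - a`. -/
theorem HasFDerivAt.abs_const_sub {E : Type*} [NormedAddCommGroup E] [NormedSpace ℝ E]
    {f : E → ℝ} {f' : E →L[ℝ] ℝ} {x : E} {a : ℝ} (hf : HasFDerivAt f f' x) (ha : a ≠ f x) :
    HasFDerivAt (fun y => |a - f y|) ((1 - 2 * (if a > f x then (1 : ℝ) else 0)) • f') x := by
  have hsub : HasFDerivAt (fun y => a - f y) (-f') x := hf.const_sub a
  split_ifs with h
  · have key := hsub.abs_of_pos (sub_pos.2 h)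
    convert key using 1
    ext v
    simp
    ring
  · have key := hsub.abs_of_neg (sub_neg.2 (lt_of_le_of_ne (not_lt.1 h) ha))
    simpa using key

/-- The derivative of the total variation distance to a fixed `q` along a family of functions
with constant total mass. -/
theorem hasFDerivAt_half_sum_abs_sub {E V : Type*} [NormedAddCommGroup E] [NormedSpace ℝ E]
    [Fintype V] {q : V → ℝ} {p : E → V → ℝ} {p' : V → E →L[ℝ] ℝ} {c : ℝ} {x : E}
    (hp : ∀ v, HasFDerivAt (fun y => p y v) (p' v) x) (hsum : ∀ y, ∑ v, p y v = c)
    (hne : ∀ v, q v ≠ p x v) :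
    HasFDerivAt (fun y => (1 / 2 : ℝ) * ∑ v, |q v - p y v|)
      (∑ v, (-(if q v > p x v then (1 : ℝ) else 0)) • p' v) x := by
  have hzero : ∑ v, p' v = 0 := by
    have h := HasFDerivAt.fun_sum (u := Finset.univ) fun v _ => hp v
    rw [funext hsum] at h
    exact h.unique (hasFDerivAt_const c x)
  have h := (HasFDerivAt.fun_sum (u := Finset.univ)
    fun v _ => (hp v).abs_const_sub (hne v)).const_mul (1 / 2 : ℝ)
  convert! h using 1
  ext w
  have hw : ∑ v, p' v w = 0 := by simpa using congrArg (fun L : E →L[ℝ] ℝ => L w) hzero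
  simp only [sum_apply, smul_apply, smul_eq_mul,
    sub_mul, one_mul, Finset.sum_sub_distrib, hw, mul_assoc, ← Finset.mul_sum, neg_mul,
    Finset.sum_neg_distrib]
  ring

/-- If `q` is a PMF on a finite nonempty set `V`, and `θ ↦ p θ` is a
parametric family of PMFs on `V` with `θ ∈ ℝ^d`, such that each `θ ↦ p θ x` is
differentiable at `θ₀`, `p θ₀ x > 0` and `q x ≠ p θ₀ x` for all `x`, then
`θ ↦ TVD(p θ, q)` is differentiable at `θ₀` with gradient
`∑ x, p θ₀ x • (∇ log p θ x) • (−r x)` where `r x = 𝟙{q x > p θ₀ x}`; this sum is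
exactly `E_{X ∼ p θ₀}[∇ log p θ X · (−r X)]`. -/
theorem gradient_tvd_eq_policy_gradient
    (V : Type*) [Fintype V] [Nonempty V] (d : ℕ)
    (q : V → ℝ) (hq_nonneg : ∀ x, 0 ≤ q x) (hq_sum : ∑ x, q x = 1)
    (p : EuclideanSpace ℝ (Fin d) → V → ℝ)
    (hp_nonneg : ∀ θ x, 0 ≤ p θ x) (hp_sum : ∀ θ, ∑ x, p θ x = 1)
    (θ₀ : EuclideanSpace ℝ (Fin d))
    (hdiff : ∀ x, DifferentiableAt ℝ (fun θ => p θ x) θ₀)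
    (hpos : ∀ x, 0 < p θ₀ x)
    (hne : ∀ x, q x ≠ p θ₀ x) :
    DifferentiableAt ℝ (fun θ => (1 / 2 : ℝ) * ∑ x, |q x - p θ x|) θ₀ ∧
    gradient (fun θ => (1 / 2 : ℝ) * ∑ x, |q x - p θ x|) θ₀ =
      ∑ x, (p θ₀ x * (-(if q x > p θ₀ x then (1 : ℝ) else 0))) •
        gradient (fun θ => Real.log (p θ x)) θ₀ := by
  have h := hasFDerivAt_half_sum_abs_sub (fun x => (hdiff x).hasFDerivAt) hp_sum hne
  refine ⟨h.differentiableAt, ?_⟩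
  simp only [gradient]
  rw [h.fderiv, map_sum]
  refine Finset.sum_congr rfl fun x _ => ?_
  rw [fderiv.log (hdiff x) (hpos x).ne', ← map_smul, smul_smul, mul_right_comm,
    mul_inv_cancel₀ (hpos x).ne', one_mul]
end

section
/- Let V be a finite nonempty set and let p and q be probability mass functions on V with p(x) > 0 for all x ∈ V. The per-token acceptance probability of speculative decoding, α := E_{X ∼ p}[min(1, q(X)/p(X))] = Σ_{x ∈ V} p(x) · min(1, q(x)/p(x)), satisfies α = Σ_{x ∈ V} min(p(x), q(x)) = 1 − TVD(p, q). In particular, minimizing the total variation distance TVD(p, q) over p is equivalent to maximizing the acceptance probability α. -/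
/-- For PMFs `p` and `q` on a finite nonempty set `V` with `p x > 0` for
all `x`, the per-token acceptance probability of speculative decoding
`α = ∑ x, p x * min 1 (q x / p x)` satisfies
`α = ∑ x, min (p x) (q x) = 1 − TVD(p, q)`. -/
theorem acceptance_prob_eq_one_sub_tvd
    (V : Type*) [Fintype V] [Nonempty V]
    (p q : V → ℝ)
    (hp_pos : ∀ x, 0 < p x) (hp_sum : ∑ x, p x = 1)
    (hq_nonneg : ∀ x, 0 ≤ q x) (hq_sum : ∑ x, q x = 1) :
    (∑ x, p x * min 1 (q x / p x)) = ∑ x, min (p x) (q x) ∧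
    (∑ x, p x * min 1 (q x / p x)) = 1 - (1 / 2 : ℝ) * ∑ x, |q x - p x| := by
  have h_min : (∑ x, p x * min 1 (q x / p x)) = ∑ x, min (p x) (q x) :=
    Finset.sum_congr rfl fun x _ => by
      rw [mul_min_of_nonneg _ _ (hp_pos x).le, mul_one, mul_div_cancel₀ _ (hp_pos x).ne']
  refine ⟨h_min, h_min.trans ?_⟩
  calc ∑ x, min (p x) (q x) = ∑ x, (1 / 2 : ℝ) * (p x + q x - |q x - p x|) :=
        Finset.sum_congr rfl fun x _ => by
          rcases le_total (p x) (q x) with h | h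
          · rw [min_eq_left h, abs_of_nonneg (sub_nonneg.2 h)]; ring
          · rw [min_eq_right h, abs_of_nonpos (sub_nonpos.2 h)]; ring
    _ = 1 - (1 / 2 : ℝ) * ∑ x, |q x - p x| := by
        rw [← Finset.mul_sum, Finset.sum_sub_distrib, Finset.sum_add_distrib, hp_sum, hq_sum]
        ring
end
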